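/- Let X be a topologically complete metric space and let S ⊆ X be a Suslin set which is not σ-upper porous. Then there exists a closed set F ⊆ S which is not σ-upper porous. -/

import Mathlib

open Metric Filter Set Topology TopologicalSpace NNReal ENNReal

/-- `porosityGamma A x R` is the supremum of all radii `r ≥ 0` for which there exists `z`
with the open ball `U(z,r)` contained in `U(x,R) \ A`. -/
noncomputable def porosityGamma {X : Type*} [MetricSpace X] (A : Set X) (x : X) (R : ℝ) :
    ℝ≥0∞ :=
  ⨆ (r : ℝ≥0) (_ : ∃ z : X, Metric.ball z (r : ℝ) ⊆ Metric.ball x R \ A), (r : ℝ≥0∞)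

/-- `A` is upper porous at `x` if `limsup_{R→0+} γ(x,R,A)/R > 0`. -/
def UpperPorousAt {X : Type*} [MetricSpace X] (A : Set X) (x : X) : Prop :=
  0 < Filter.limsup (fun R : ℝ => porosityGamma A x R / ENNReal.ofReal R) (𝓝[>] (0 : ℝ))

/-- `A` is upper porous if it is upper porous at each of its points. -/
def UpperPorous {X : Type*} [MetricSpace X] (A : Set X) : Prop :=
  ∀ x ∈ A, UpperPorousAt A x

/-- `A` is σ-upper porous if it is a countable union of upper porous sets. -/
def SigmaUpperPorous {X : Type*} [MetricSpace X] (A : Set X) : Prop :=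
  ∃ B : ℕ → Set X, (∀ n, UpperPorous (B n)) ∧ A = ⋃ n, B n

/-- A metric space is topologically complete if its topology is induced by some complete
metric. -/
def TopComplete (X : Type*) [m : MetricSpace X] : Prop :=
  ∃ m' : MetricSpace X, m'.toUniformSpace.toTopologicalSpace =
      m.toUniformSpace.toTopologicalSpace ∧ @CompleteSpace X m'.toUniformSpace

/-! ### Basic facts on upper porosity -/

section Basic

variable {X : Type*} [MetricSpace X]

theorem porosityGamma_anti {A B : Set X} (h : A ⊆ B) (x : X) (R : ℝ) :
    porosityGamma B x R ≤ porosityGamma A x R := by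
  refine iSup_mono fun r => iSup_mono' ?_
  rintro ⟨z, hz⟩
  exact ⟨⟨z, hz.trans (sdiff_subset_sdiff_right h)⟩, le_rfl⟩

theorem UpperPorous.mono {A B : Set X} (h : A ⊆ B) (hB : UpperPorous B) : UpperPorous A := by
  intro x hx
  refine lt_of_lt_of_le (hB x (h hx)) (limsup_le_limsup (Eventually.of_forall fun R => ?_))
  exact ENNReal.div_le_div_right (porosityGamma_anti h x R) _

theorem UpperPorous.sigmaUpperPorous {A : Set X} (h : UpperPorous A) : SigmaUpperPorous A :=
  ⟨fun _ => A, fun _ => h, (iUnion_const A).symm⟩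

theorem sigmaUpperPorous_empty : SigmaUpperPorous (∅ : Set X) :=
  UpperPorous.sigmaUpperPorous fun _ hx => hx.elim

theorem sigmaUpperPorous_of_subset_iUnion {ι : Type*} [Countable ι] {A : Set X} {B : ι → Set X}
    (hB : ∀ i, SigmaUpperPorous (B i)) (hA : A ⊆ ⋃ i, B i) : SigmaUpperPorous A := by
  rcases isEmpty_or_nonempty ι with hι | hι
  · have : A = ∅ := subset_empty_iff.1 (by simpa using hA)
    exact this ▸ sigmaUpperPorous_empty
  choose C hC hBC using hB
  obtain ⟨g, hg⟩ := exists_surjective_nat (ι × ℕ)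
  refine ⟨fun n => A ∩ C (g n).1 (g n).2,
    fun n => UpperPorous.mono inter_subset_right (hC _ _), ?_⟩
  ext x
  simp only [mem_iUnion, mem_inter_iff, exists_and_left, iff_self_and]
  intro hx
  obtain ⟨i, hi⟩ := mem_iUnion.1 (hA hx)
  rw [hBC i] at hi
  obtain ⟨m, hm⟩ := mem_iUnion.1 hi
  obtain ⟨n, hn⟩ := hg (i, m)
  exact ⟨n, by rw [hn]; exact hm⟩

theorem SigmaUpperPorous.mono {A B : Set X} (h : A ⊆ B) (hB : SigmaUpperPorous B) :
    SigmaUpperPorous A :=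
  sigmaUpperPorous_of_subset_iUnion (ι := Unit) (fun _ => hB)
    (h.trans (subset_iUnion (fun _ : Unit => B) ()))

theorem SigmaUpperPorous.union {A B : Set X} (hA : SigmaUpperPorous A)
    (hB : SigmaUpperPorous B) : SigmaUpperPorous (A ∪ B) :=
  sigmaUpperPorous_of_subset_iUnion (ι := Bool) (B := fun b => cond b A B)
    (fun b => by cases b <;> assumption) (by rw [union_eq_iUnion])

/-- Every ball of radius `η * R` inside `ball x R` meets `E`, for all `R < ρ`. -/
def MeetsBalls (E : Set X) (x : X) (η ρ : ℝ) : Prop :=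
  ∀ R, 0 < R → R < ρ → ∀ z, ball z (η * R) ⊆ ball x R → (ball z (η * R) ∩ E).Nonempty

theorem exists_meetsBalls {E : Set X} {x : X} (h : ¬ UpperPorousAt E x) {η : ℝ} (hη : 0 < η) :
    ∃ ρ > 0, MeetsBalls E x η ρ := by
  have h0 : limsup (fun R : ℝ => porosityGamma E x R / ENNReal.ofReal R) (𝓝[>] (0 : ℝ))
      < ENNReal.ofReal η := by
    rw [UpperPorousAt, not_lt, nonpos_iff_eq_zero] at h
    rw [h]
    exact ENNReal.ofReal_pos.2 hη
  obtain ⟨ρ, hρ, hρ'⟩ := (mem_nhdsGT_iff_exists_Ioo_subset).1 (eventually_lt_of_limsup_lt h0)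
  refine ⟨ρ, hρ, fun R hR hRρ z hz => ?_⟩
  by_contra hne
  have hlt : porosityGamma E x R / ENNReal.ofReal R < ENNReal.ofReal η := hρ' ⟨hR, hRρ⟩
  rw [ENNReal.div_lt_iff (Or.inl (ENNReal.ofReal_pos.2 hR).ne') (Or.inl ENNReal.ofReal_ne_top),
    ← ENNReal.ofReal_mul hη.le] at hlt
  refine hlt.not_ge ?_
  refine le_iSup₂_of_le (η * R).toNNReal ⟨z, ?_⟩ le_rfl
  rw [Real.coe_toNNReal _ (by positivity)]
  exact fun y hy => ⟨hz hy, fun hyE => hne ⟨y, hy, hyE⟩⟩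

theorem exists_ball_subset_of_lt_limsup {B : Set X} {x : X} {η : ℝ} (hη : 0 < η)
    (h : ENNReal.ofReal η <
      limsup (fun R : ℝ => porosityGamma B x R / ENNReal.ofReal R) (𝓝[>] (0 : ℝ)))
    {ρ : ℝ} (hρ : 0 < ρ) :
    ∃ R, 0 < R ∧ R < ρ ∧ ∃ z, ball z (η * R) ⊆ ball x R \ B := by
  obtain ⟨R, hlt, hR⟩ :=
    ((frequently_lt_of_lt_limsup (by isBoundedDefault) h).and_eventually
      (Ioo_mem_nhdsGT hρ)).exists
  refine ⟨R, hR.1, hR.2, ?_⟩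
  rw [ENNReal.lt_div_iff_mul_lt (Or.inl (ENNReal.ofReal_pos.2 hR.1).ne')
    (Or.inl ENNReal.ofReal_ne_top), ← ENNReal.ofReal_mul hη.le, porosityGamma] at hlt
  obtain ⟨r, hr⟩ := lt_iSup_iff.1 hlt
  obtain ⟨⟨z, hz⟩, hr⟩ := lt_iSup_iff.1 hr
  refine ⟨z, (ball_subset_ball ?_).trans hz⟩
  rw [← ENNReal.ofReal_coe_nnreal] at hr
  exact (ENNReal.ofReal_lt_ofReal_iff'.1 hr).1.le

theorem exists_maximal_separated {Y : Type*} (g : Y → X) (E : Set Y) {t : ℝ} (ht : 0 < t) :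
    ∃ M ⊆ E, (∀ a ∈ M, ∀ b ∈ M, a ≠ b → t ≤ dist (g a) (g b)) ∧
      ∀ a ∈ E, ∃ b ∈ M, dist (g a) (g b) < t := by
  obtain ⟨M, hM⟩ := zorn_subset
    {M : Set Y | M ⊆ E ∧ ∀ a ∈ M, ∀ b ∈ M, a ≠ b → t ≤ dist (g a) (g b)} (by
      intro c hc hchain
      refine ⟨⋃₀ c, ⟨sUnion_subset fun s hs => (hc hs).1, ?_⟩,
        fun s hs => subset_sUnion_of_mem hs⟩
      rintro a ⟨s, hs, ha⟩ b ⟨s', hs', hb⟩ hab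
      rcases hchain.total hs hs' with h | h
      · exact (hc hs').2 a (h ha) b hb hab
      · exact (hc hs).2 a ha b (h hb) hab)
  refine ⟨M, hM.prop.1, hM.prop.2, fun a ha => ?_⟩
  by_contra! hfar
  have hins : insert a M ∈
      {M : Set Y | M ⊆ E ∧ ∀ a ∈ M, ∀ b ∈ M, a ≠ b → t ≤ dist (g a) (g b)} := by
    refine ⟨insert_subset ha hM.prop.1, ?_⟩
    rintro b (rfl | hb) d (rfl | hd) hbd
    · exact (hbd rfl).elim
    · exact hfar d hd
    · rw [dist_comm]; exact hfar b hb
    · exact hM.prop.2 b hb d hd hbd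
  have := hfar a (hM.le_of_ge hins (subset_insert a M) (mem_insert a M))
  rw [dist_self] at this
  exact this.not_gt ht

end Basic

/-! ### Thick sets in the parameter space -/

section Thick

variable {X Z : Type*} [MetricSpace X] [MetricSpace Z] {f : Z → X}

/-- Images of nonempty relatively open subsets of `A` are not σ-upper porous. -/
def Thick (f : Z → X) (A : Set Z) : Prop :=
  ∀ V, IsOpen V → (V ∩ A).Nonempty → ¬ SigmaUpperPorous (f '' (V ∩ A))

theorem Thick.inter_open {A V : Set Z} (hA : Thick f A) (hV : IsOpen V) : Thick f (V ∩ A) := by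
  intro W hW hne
  rw [← inter_assoc] at hne ⊢
  exact hA _ (hW.inter hV) hne

theorem exists_thick_subset [SecondCountableTopology Z] {A : Set Z}
    (hA : ¬ SigmaUpperPorous (f '' A)) : ∃ B ⊆ A, B.Nonempty ∧ Thick f B := by
  let U : Set (Set Z) := {V ∈ countableBasis Z | SigmaUpperPorous (f '' (V ∩ A))}
  have hUc : U.Countable := (countable_countableBasis Z).mono (sep_subset _ _)
  have : Countable U := hUc.to_subtype
  have hU : SigmaUpperPorous (f '' (A ∩ ⋃₀ U)) := by
    refine sigmaUpperPorous_of_subset_iUnion (B := fun V : U => f '' (V.1 ∩ A))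
      (fun V => V.2.2) ?_
    rintro _ ⟨a, ⟨ha, V, hV, haV⟩, rfl⟩
    exact mem_iUnion.2 ⟨⟨V, hV⟩, a, ⟨haV, ha⟩, rfl⟩
  refine ⟨A \ ⋃₀ U, sdiff_subset, ?_, ?_⟩
  · by_contra hne
    rw [not_nonempty_iff_eq_empty, sdiff_eq_empty] at hne
    rw [inter_eq_left.2 hne] at hU
    exact hA hU
  · rintro V hV ⟨x, hxV, hxA, hxU⟩ hσ
    obtain ⟨W, hW, hxW, hWV⟩ := (isBasis_countableBasis Z).exists_subset_of_mem_open hxV hV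
    refine hxU ⟨W, ⟨hW, (hσ.union hU).mono ?_⟩, hxW⟩
    rintro _ ⟨a, ⟨haW, haA⟩, rfl⟩
    by_cases haU : a ∈ ⋃₀ U
    · exact Or.inr ⟨a, ⟨haA, haU⟩, rfl⟩
    · exact Or.inl ⟨a, ⟨hWV haW, haA, haU⟩, rfl⟩

/-- Every nonempty relatively open part of a thick set contains small thick sets `A'' ⊆ A'`, such
that the image of `A'` has porosity at most `η`, uniformly at all points of the image of `A''`. -/
theorem Thick.exists_refinement [SecondCountableTopology Z] {A V : Set Z} (hA : Thick f A)
    (hV : IsOpen V) (hne : (V ∩ A).Nonempty) {e η : ℝ} (he : 0 < e) (hη : 0 < η) :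
    ∃ A' A'' : Set Z, A' ⊆ V ∩ A ∧ A'' ⊆ A' ∧ A''.Nonempty ∧ Thick f A' ∧ Thick f A'' ∧
      (∀ a ∈ A', ∀ b ∈ A', dist a b ≤ e) ∧
      ∃ ρ > 0, ∀ a ∈ A'', MeetsBalls (f '' A') (f a) η ρ := by
  obtain ⟨x, hxV, hxA⟩ := hne
  let A' := (V ∩ ball x (e / 2)) ∩ A
  have hA' : Thick f A' := hA.inter_open (hV.inter isOpen_ball)
  have hxA' : x ∈ A' := ⟨⟨hxV, mem_ball_self (half_pos he)⟩, hxA⟩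
  let P : ℕ → Set Z := fun j => {a ∈ A' | MeetsBalls (f '' A') (f a) η (1 / (j + 1))}
  have hP : ∃ j, ¬ SigmaUpperPorous (f '' P j) := by
    by_contra! hP
    have hQ : UpperPorous (f '' A' \ ⋃ j, f '' P j) := by
      rintro y ⟨⟨a, ha, rfl⟩, hy⟩
      have : UpperPorousAt (f '' A') (f a) := by
        by_contra hnot
        obtain ⟨ρ, hρ, h⟩ := exists_meetsBalls hnot hη
        obtain ⟨j, hj⟩ := exists_nat_one_div_lt hρ
        exact hy (mem_iUnion.2 ⟨j, a, ⟨ha, fun R h0 hR => h R h0 (hR.trans hj)⟩, rfl⟩)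
      refine lt_of_lt_of_le this (limsup_le_limsup (Eventually.of_forall fun R => ?_))
      exact ENNReal.div_le_div_right (porosityGamma_anti sdiff_subset _ R) _
    have hσ := hQ.sigmaUpperPorous.union
      (sigmaUpperPorous_of_subset_iUnion hP (subset_refl _))
    refine hA' univ isOpen_univ ⟨x, mem_univ x, hxA'⟩ (hσ.mono ?_)
    rw [univ_inter, sdiff_union_self]
    exact subset_union_left
  obtain ⟨j, hj⟩ := hP
  obtain ⟨A'', hsub, hne, hthick⟩ := exists_thick_subset hj
  refine ⟨A', A'', fun a ha => ⟨ha.1.1, ha.2⟩, fun a ha => (hsub ha).1, hne, hA', hthick,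
    fun a ha b hb => ?_, 1 / (j + 1), by positivity, fun a ha => (hsub ha).2⟩
  have h1 : dist a x < e / 2 := ha.1.2
  have h2 : dist b x < e / 2 := hb.1.2
  linarith [dist_triangle_right a b x]

end Thick

/-! ### Nodes of the construction -/

section Nodes

variable {X Z : Type*} [MetricSpace X] [MetricSpace Z] {f : Z → X}

/-- A node consists of a point `f z`, a finite decreasing chain `A 0 ⊇ ⋯ ⊇ A n ∋ z` of thick sets,
each of which has small porosity at the points of the next one, a radius `δ` and a depth `k`. -/
structure PorosityNode (f : Z → X) where
  z : Z
  n : ℕ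
  k : ℕ
  A : ℕ → Set Z
  δ : ℝ
  mem : z ∈ A n
  anti : ∀ i < n, A (i + 1) ⊆ A i
  thick : ∀ i ≤ n, Thick f (A i)
  meets : ∀ i < n, ∃ ρ > 0, ∀ a ∈ A (i + 1), MeetsBalls (f '' A i) (f a) (1 / (4 * (i + 1))) ρ
  diam : ∀ i ≤ n, ∀ a ∈ A i, ∀ b ∈ A i, dist a b ≤ (1 / 2) ^ i
  pos : 0 < δ
  le : δ ≤ (1 / 2) ^ k

namespace PorosityNode

/-- The point of `X` represented by a node. -/
def pt (c : PorosityNode f) : X := f c.z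

/-- The radius within which points of level `i` are added near the node. -/
noncomputable def rad (c : PorosityNode f) (i : ℕ) : ℝ := c.δ / 8 ^ i

theorem rad_pos (c : PorosityNode f) (i : ℕ) : 0 < c.rad i := div_pos c.pos (by positivity)

theorem rad_succ (c : PorosityNode f) (i : ℕ) : c.rad (i + 1) = c.rad i / 8 := by
  rw [rad, rad, pow_succ, div_div]

theorem rad_zero (c : PorosityNode f) : c.rad 0 = c.δ := by simp [rad]

theorem rad_anti (c : PorosityNode f) : Antitone c.rad :=
  antitone_nat_of_succ_le fun i => by rw [rad_succ]; linarith [c.rad_pos i]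

theorem rad_le (c : PorosityNode f) (i : ℕ) : c.rad i ≤ (1 / 2) ^ c.k :=
  (c.rad_anti (Nat.zero_le i)).trans (c.rad_zero ▸ c.le)

theorem rad_mono {c d : PorosityNode f} (h : d.δ ≤ c.δ / 2) (i : ℕ) :
    d.rad i ≤ c.rad i / 2 := by
  rw [rad, rad, div_right_comm]
  exact div_le_div_of_nonneg_right h (by positivity)

theorem A_subset (c : PorosityNode f) {i j : ℕ} (hij : i ≤ j) (hj : j ≤ c.n) :
    c.A j ⊆ c.A i := by
  induction j, hij using Nat.le_induction with
  | base => exact subset_rfl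
  | succ j hij ih => exact (c.anti j (by omega)).trans (ih (by omega))

theorem mem_A (c : PorosityNode f) {i : ℕ} (hi : i ≤ c.n) : c.z ∈ c.A i :=
  c.A_subset hi le_rfl c.mem

/-- `d` is the node `c` with a smaller radius. -/
structure IsShrink (c d : PorosityNode f) : Prop where
  z : d.z = c.z
  n : d.n = c.n
  k : d.k = c.k + 1
  A : d.A = c.A
  δ : d.δ ≤ c.δ / 2

/-- `d` arises from `c` by choosing a new point in the set of level `l`. -/
structure IsMove (c d : PorosityNode f) (l : ℕ) : Prop where
  le : l ≤ c.n
  n : d.n = l + 1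
  k : d.k = c.k + 1
  A_lt : ∀ j < l, d.A j = c.A j
  A_sub : d.A l ⊆ c.A l
  diam : ∀ a ∈ d.A l, ∀ b ∈ d.A l, dist a b ≤ (1 / 2) ^ c.k
  dist : dist d.pt c.pt < c.rad l
  δ : d.δ ≤ c.δ / 2

/-- `d` is a successor of `c` of level at least `i`. -/
def Succ (i : ℕ) (c d : PorosityNode f) : Prop := IsShrink c d ∨ ∃ l, i ≤ l ∧ IsMove c d l

theorem Succ.mono {i j : ℕ} (hij : i ≤ j) {c d : PorosityNode f} (h : Succ j c d) :
    Succ i c d :=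
  h.imp id fun ⟨l, hl, hm⟩ => ⟨l, hij.trans hl, hm⟩

theorem Succ.δ_le {i : ℕ} {c d : PorosityNode f} (h : Succ i c d) : d.δ ≤ c.δ / 2 := by
  rcases h with h | ⟨l, -, h⟩
  exacts [h.δ, h.δ]

theorem Succ.k_eq {i : ℕ} {c d : PorosityNode f} (h : Succ i c d) : d.k = c.k + 1 := by
  rcases h with h | ⟨l, -, h⟩
  exacts [h.k, h.k]

theorem Succ.n_le {i : ℕ} {c d : PorosityNode f} (h : Succ i c d) (hi : i ≤ c.n) : i ≤ d.n := by
  rcases h with h | ⟨l, hl, h⟩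
  · exact h.n ▸ hi
  · rw [h.n]; omega

theorem Succ.A_eq {i j : ℕ} {c d : PorosityNode f} (h : Succ i c d) (hj : j < i) :
    d.A j = c.A j := by
  rcases h with h | ⟨l, hl, h⟩
  · rw [h.A]
  · exact h.A_lt j (by omega)

theorem Succ.A_subset {i : ℕ} {c d : PorosityNode f} (h : Succ i c d) : d.A i ⊆ c.A i := by
  rcases h with h | ⟨l, hl, h⟩
  · rw [h.A]
  · rcases hl.eq_or_lt with rfl | hl
    · exact h.A_sub
    · rw [h.A_lt i hl]

theorem Succ.dist_add_le {i : ℕ} {c d : PorosityNode f} (h : Succ i c d) :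
    dist d.pt c.pt + 2 * d.rad i ≤ 2 * c.rad i := by
  have h1 := rad_mono h.δ_le i
  have h0 := c.rad_pos i
  rcases h with h | ⟨l, hl, h⟩
  · rw [pt, pt, h.z, dist_self]; linarith
  · linarith [h.dist, c.rad_anti hl]

/-- The node with halved radius. -/
noncomputable def shrink (c : PorosityNode f) : PorosityNode f :=
  { c with
    k := c.k + 1
    δ := c.δ / 2
    pos := half_pos c.pos
    le := by have := c.le; rw [pow_succ]; linarith }

theorem isShrink_shrink (c : PorosityNode f) : IsShrink c c.shrink :=
  ⟨rfl, rfl, rfl, rfl, le_rfl⟩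

/-- A family of successors of `c` of level at least `l`, with uniformly separated points and
a locally finite family of territories. -/
structure IsLayer (c : PorosityNode f) (l : ℕ) (N : Set (PorosityNode f)) : Prop where
  succ : ∀ d ∈ N, Succ l c d
  sep : ∃ s > 0, ∀ d ∈ N, ∀ d' ∈ N, d ≠ d' → s ≤ dist d.pt d'.pt
  rad : ∃ δ₀ > 0, ∀ d ∈ N, δ₀ ≤ d.δ
  locallyFinite : ∀ x : X, ∃ u > 0,
    {d ∈ N | (closedBall d.pt (2 * d.δ) ∩ ball x u).Nonempty}.Finite

/-- Points of level `l` near `c` outside the territory of `d ∈ N` are well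
approximated by points of `N'` (relative to the distance from `d`). -/
def Approximates (c : PorosityNode f) (l : ℕ) (N N' : Set (PorosityNode f)) : Prop :=
  ∀ x ∈ f '' c.A l, dist x c.pt < c.rad l → ∀ d ∈ N, d.rad l ≤ dist x d.pt →
    ∃ d' ∈ N', dist x d'.pt ≤ 1 / (16 * (c.n + 1)) * dist x d.pt

theorem isLayer_singleton_shrink (c : PorosityNode f) (l : ℕ) : IsLayer c l {c.shrink} where
  succ := by
    rintro d rfl
    exact Or.inl c.isShrink_shrink
  sep := ⟨1, one_pos, by
    rintro d rfl d' rfl h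
    exact (h rfl).elim⟩
  rad := ⟨_, c.shrink.pos, by
    rintro d rfl
    exact le_rfl⟩
  locallyFinite := fun x => ⟨1, one_pos, (finite_singleton c.shrink).subset (sep_subset _ _)⟩

/-- The points of level `l` at which a successor node can be placed. -/
def IsRefined (c : PorosityNode f) (l : ℕ) (a : Z) : Prop :=
  ∃ A' A'' : Set Z, A' ⊆ c.A l ∧ A'' ⊆ A' ∧ a ∈ A'' ∧ Thick f A' ∧ Thick f A'' ∧
    (∀ b ∈ A', ∀ b' ∈ A', dist b b' ≤ min ((1 / 2) ^ c.k) ((1 / 2) ^ (l + 1))) ∧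
    ∃ ρ > 0, ∀ b ∈ A'', MeetsBalls (f '' A') (f b) (1 / (4 * (l + 1))) ρ

theorem exists_isRefined [SecondCountableTopology Z] (c : PorosityNode f) {l : ℕ} (hl : l ≤ c.n)
    {V : Set Z} (hV : IsOpen V) (hne : (V ∩ c.A l).Nonempty) : ∃ a ∈ V, c.IsRefined l a := by
  obtain ⟨A', A'', h1, h2, ⟨a, ha⟩, h3, h4, h5, h6⟩ := (c.thick l hl).exists_refinement hV hne
    (e := min ((1 / 2) ^ c.k) ((1 / 2) ^ (l + 1))) (η := 1 / (4 * (l + 1)))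
    (by positivity) (by positivity)
  exact ⟨a, (h1 (h2 ha)).1, A', A'', fun b hb => (h1 hb).2, h2, ha, h3, h4, h5, h6⟩

theorem IsRefined.exists_isMove {c : PorosityNode f} {l : ℕ} (hl : l ≤ c.n) {a : Z}
    (h : c.IsRefined l a) (hdist : dist (f a) c.pt < c.rad l) {δ : ℝ} (hδ : 0 < δ)
    (hδc : δ ≤ c.δ / 2) : ∃ d : PorosityNode f, d.z = a ∧ d.δ = δ ∧ IsMove c d l := by
  obtain ⟨A', A'', h1, h2, ha, h3, h4, h5, h6⟩ := h
  let A : ℕ → Set Z := fun j => if j < l then c.A j else if j = l then A' else A''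
  have hlt : ∀ j < l, A j = c.A j := fun j hj => if_pos hj
  have hl0 : A l = A' := by simp [A]
  have hl1 : A (l + 1) = A'' := by simp [A]
  have hcases : ∀ {p : ℕ → Prop}, (∀ j < l, p j) → p l → ∀ j < l + 1, p j := by
    intro p hp hpl j hj
    rcases Nat.lt_succ_iff_lt_or_eq.1 hj with h | rfl
    exacts [hp j h, hpl]
  have hcases' : ∀ {p : ℕ → Prop}, (∀ j < l, p j) → p l → p (l + 1) → ∀ j ≤ l + 1, p j := by
    intro p hp hpl hpl' j hj
    rcases hj.lt_or_eq with h | rfl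
    exacts [hcases hp hpl j h, hpl']
  have hsub : ∀ j < l, A (j + 1) ⊆ c.A (j + 1) := by
    intro j hj
    rcases (Nat.succ_le_of_lt hj).lt_or_eq with h | h
    · rw [hlt _ h]
    · rw [show j + 1 = l from h, hl0]
      exact h1
  refine ⟨{
      z := a
      n := l + 1
      k := c.k + 1
      A := A
      δ := δ
      mem := hl1 ▸ ha
      anti := hcases
        (fun j hj => by
          rw [hlt j hj]
          exact (hsub j hj).trans (c.anti j (by omega)))
        (by rw [hl0, hl1]; exact h2)
      thick := hcases' (fun j hj => by rw [hlt j hj]; exact c.thick j (by omega))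
        (hl0 ▸ h3) (hl1 ▸ h4)
      meets := hcases
        (fun j hj => by
          obtain ⟨ρ, hρ, h⟩ := c.meets j (by omega)
          rw [hlt j hj]
          exact ⟨ρ, hρ, fun b hb => h b (hsub j hj hb)⟩)
        (by rw [hl0, hl1]; exact h6)
      diam := hcases' (fun j hj => by rw [hlt j hj]; exact c.diam j (by omega))
        (by
          rw [hl0]
          exact fun b hb b' hb' => c.diam l hl b (h1 hb) b' (h1 hb'))
        (by
          rw [hl1]
          exact fun b hb b' hb' => (h5 b (h2 hb) b' (h2 hb')).trans (min_le_right _ _))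
      pos := hδ
      le := by have := c.le; rw [pow_succ]; linarith }, rfl, rfl, ?_⟩
  exact {
    le := hl
    n := rfl
    k := rfl
    A_lt := hlt
    A_sub := by
      change A l ⊆ _
      rw [hl0]; exact h1
    diam := by
      change ∀ a ∈ A l, ∀ b ∈ A l, _
      rw [hl0]
      exact fun b hb b' hb' => (h5 b hb b' hb').trans (min_le_left _ _)
    dist := hdist
    δ := hδc }

theorem IsLayer.extend [SecondCountableTopology Z] (hf : Continuous f) {c : PorosityNode f}
    {l : ℕ} (hl : l ≤ c.n) {N : Set (PorosityNode f)} (hN : IsLayer c (l + 1) N) :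
    ∃ N', IsLayer c l N' ∧ N ⊆ N' ∧ Approximates c l N N' := by
  obtain ⟨s, hs, hsep⟩ := hN.sep
  obtain ⟨δ₀, hδ₀, hrad⟩ := hN.rad
  set ε : ℝ := 1 / (16 * (c.n + 1)) with hε
  have hε0 : 0 < ε := by positivity
  have hε1 : ε ≤ 1 := by
    rw [hε, div_le_one (by positivity)]
    have : (0 : ℝ) ≤ c.n := Nat.cast_nonneg _
    linarith
  set h : ℝ := min (s * ε / 4) (δ₀ / 8 ^ l / 2) with hh
  have hh0 : 0 < h := by positivity
  have hhs : h ≤ s * ε / 4 := min_le_left _ _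
  have hhrad : ∀ d ∈ N, h ≤ d.rad l / 2 := fun d hd => by
    refine (min_le_right _ _).trans ?_
    have : δ₀ / 8 ^ l ≤ d.rad l := div_le_div_of_nonneg_right (hrad d hd) (by positivity)
    linarith
  set t : ℝ := ε * h / 4 with ht
  have ht0 : 0 < t := by positivity
  have hth : t ≤ h := by nlinarith
  obtain ⟨M, hME, hMsep, hMmax⟩ := exists_maximal_separated f
    {a | c.IsRefined l a ∧ dist (f a) c.pt < c.rad l ∧ ∀ d ∈ N, h ≤ dist (f a) d.pt} ht0
  have hδ₁ : 0 < min (c.δ / 2) (t / 8) := lt_min (half_pos c.pos) (by positivity)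
  have hnode : ∀ a : M, ∃ d : PorosityNode f, d.z = a ∧ d.δ = min (c.δ / 2) (t / 8) ∧
      IsMove c d l := fun a =>
    (hME a.2).1.exists_isMove hl (hME a.2).2.1 hδ₁ (min_le_left _ _)
  choose g hgz hgδ hgm using hnode
  have hgpt : ∀ a, (g a).pt = f a := fun a => by rw [pt, hgz]
  refine ⟨N ∪ range g, ⟨?_, ?_, ?_, ?_⟩, subset_union_left, ?_⟩
  · rintro d (hd | ⟨a, rfl⟩)
    · exact (hN.succ d hd).mono (Nat.le_succ l)
    · exact Or.inr ⟨l, le_rfl, hgm a⟩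
  · have hmix : ∀ d ∈ N, ∀ a, t ≤ dist d.pt (g a).pt := fun d hd a => by
      rw [dist_comm, hgpt]
      exact hth.trans ((hME a.2).2.2 d hd)
    refine ⟨min s t, lt_min hs ht0, ?_⟩
    rintro d (hd | ⟨a, rfl⟩) d' (hd' | ⟨a', rfl⟩) hne
    · exact (min_le_left _ _).trans (hsep d hd d' hd' hne)
    · exact (min_le_right _ _).trans (hmix d hd a')
    · rw [dist_comm]
      exact (min_le_right _ _).trans (hmix d' hd' a)
    · rw [hgpt, hgpt]
      refine (min_le_right _ _).trans (hMsep a a.2 a' a'.2 fun h => hne ?_)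
      rw [Subtype.ext h]
  · refine ⟨min δ₀ (min (c.δ / 2) (t / 8)), lt_min hδ₀ hδ₁, ?_⟩
    rintro d (hd | ⟨a, rfl⟩)
    · exact (min_le_left _ _).trans (hrad d hd)
    · rw [hgδ]
      exact min_le_right _ _
  · intro x
    obtain ⟨u, hu, hfin⟩ := hN.locallyFinite x
    have hnear : ∀ a, (closedBall (g a).pt (2 * (g a).δ) ∩ ball x (t / 8)).Nonempty →
        dist (f a) x < 3 * t / 8 := by
      rintro a ⟨w, hw, hwx⟩
      rw [mem_closedBall, hgpt] at hw
      rw [mem_ball] at hwx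
      have := hgδ a ▸ min_le_right (c.δ / 2) (t / 8)
      linarith [dist_triangle_left (f a) x w]
    have hsub : {d ∈ range g |
        (closedBall d.pt (2 * d.δ) ∩ ball x (t / 8)).Nonempty}.Subsingleton := by
      rintro _ ⟨⟨a, rfl⟩, ha⟩ _ ⟨⟨b, rfl⟩, hb⟩
      by_contra hne
      have hab : (a : Z) ≠ b := fun h => hne (by rw [Subtype.ext h])
      linarith [hMsep a a.2 b b.2 hab, hnear a ha, hnear b hb,
        dist_triangle_right (f a) (f b) x]
    refine ⟨min u (t / 8), lt_min hu (by positivity), (hfin.union hsub.finite).subset ?_⟩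
    rintro d ⟨hd, hne⟩
    rcases hd with hd | hd
    · exact Or.inl ⟨hd, hne.mono (inter_subset_inter_right _ (ball_subset_ball (min_le_left _ _)))⟩
    · exact Or.inr
        ⟨hd, hne.mono (inter_subset_inter_right _ (ball_subset_ball (min_le_right _ _)))⟩
  · rintro x ⟨a₀, ha₀, rfl⟩ hx d hd hdx
    obtain ⟨a, ⟨hat, hac⟩, haR⟩ := c.exists_isRefined hl
      ((isOpen_ball.inter isOpen_ball : IsOpen (ball (f a₀) t ∩ ball c.pt (c.rad l))).preimage hf)
      ⟨a₀, ⟨mem_ball_self ht0, hx⟩, ha₀⟩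
    rw [mem_ball, dist_comm] at hat
    have hhd := hhrad d hd
    by_cases hfar : ∀ d' ∈ N, h ≤ dist (f a) d'.pt
    · obtain ⟨b, hb, hab⟩ := hMmax a ⟨haR, hac, hfar⟩
      refine ⟨g ⟨b, hb⟩, Or.inr ⟨_, rfl⟩, ?_⟩
      rw [hgpt]
      have h1 : dist (f a₀) (f b) ≤ 2 * t := by
        linarith [dist_triangle (f a₀) (f a) (f b)]
      have h2 : h ≤ dist (f a₀) d.pt := by linarith
      have h3 := mul_le_mul_of_nonneg_left h2 hε0.le
      linarith
    · push Not at hfar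
      obtain ⟨d', hd', hlt⟩ := hfar
      refine ⟨d', Or.inl hd', ?_⟩
      have h1 : dist (f a₀) d'.pt < t + h := by
        linarith [dist_triangle (f a₀) (f a) d'.pt]
      have hne : d ≠ d' := by
        rintro rfl
        linarith
      have h2 := hsep d hd d' hd' hne
      have h3 := dist_triangle_left d.pt d'.pt (f a₀)
      have h4 : s * ε ≤ s := by nlinarith
      have h5 : s / 2 ≤ dist (f a₀) d.pt := by linarith
      have h6 := mul_le_mul_of_nonneg_left h5 hε0.le
      linarith

/-- The successors of a node, sorted by levels. -/
theorem exists_layers [SecondCountableTopology Z] (hf : Continuous f) (c : PorosityNode f) :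
    ∃ N : ℕ → Set (PorosityNode f), Antitone N ∧ (∀ i, IsLayer c i (N i)) ∧
      (∀ i, c.shrink ∈ N i) ∧ ∀ i ≤ c.n, Approximates c i (N (i + 1)) (N i) := by
  have hext : ∀ l N, ∃ N', l ≤ c.n → IsLayer c (l + 1) N →
      IsLayer c l N' ∧ N ⊆ N' ∧ Approximates c l N N' := by
    intro l N
    by_cases h : l ≤ c.n ∧ IsLayer c (l + 1) N
    · obtain ⟨N', hN'⟩ := h.2.extend hf h.1
      exact ⟨N', fun _ _ => hN'⟩
    · exact ⟨∅, fun h1 h2 => (h ⟨h1, h2⟩).elim⟩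
  choose ext hext using hext
  let G : ℕ → Set (PorosityNode f) := fun j =>
    Nat.rec {c.shrink} (fun j N => ext (c.n - j) N) j
  have hG : ∀ j ≤ c.n + 1, IsLayer c (c.n + 1 - j) (G j) := by
    intro j
    induction j with
    | zero => exact fun _ => c.isLayer_singleton_shrink _
    | succ j ih =>
      intro hj
      have h := ih (by omega)
      rw [show c.n + 1 - j = c.n - j + 1 by omega] at h
      rw [show c.n + 1 - (j + 1) = c.n - j by omega]
      exact (hext (c.n - j) (G j) (by omega) h).1
  have hN : ∀ i ≤ c.n, G (c.n + 1 - (i + 1)) ⊆ G (c.n + 1 - i) ∧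
      Approximates c i (G (c.n + 1 - (i + 1))) (G (c.n + 1 - i)) := by
    intro i hi
    have h := hG (c.n + 1 - (i + 1)) (by omega)
    rw [show c.n + 1 - (c.n + 1 - (i + 1)) = i + 1 by omega] at h
    have h' := (hext i _ hi h).2
    have : G (c.n + 1 - i) = ext i (G (c.n + 1 - (i + 1))) := by
      rw [show c.n + 1 - i = (c.n + 1 - (i + 1)) + 1 by omega]
      change ext (c.n - (c.n + 1 - (i + 1))) _ = _
      rw [show c.n - (c.n + 1 - (i + 1)) = i by omega]
    rwa [this]
  have hanti : Antitone fun i => G (c.n + 1 - i) := antitone_nat_of_succ_le fun i => by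
    rcases le_or_gt i c.n with hi | hi
    · exact (hN i hi).1
    · rw [show c.n + 1 - (i + 1) = c.n + 1 - i by omega]
  refine ⟨fun i => G (c.n + 1 - i), hanti, fun i => ?_, fun i => ?_, fun i hi => (hN i hi).2⟩
  · rcases le_or_gt i c.n with hi | hi
    · have := hG (c.n + 1 - i) (by omega)
      rwa [show c.n + 1 - (c.n + 1 - i) = i by omega] at this
    · change IsLayer c i (G (c.n + 1 - i))
      rw [show c.n + 1 - i = 0 by omega]
      exact c.isLayer_singleton_shrink i
  · refine hanti (le_max_left i (c.n + 1)) ?_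
    change c.shrink ∈ G (c.n + 1 - max i (c.n + 1))
    rw [show c.n + 1 - max i (c.n + 1) = 0 by omega]
    rfl

/-- `step c i` is the family of successors of `c` of level at least `i`. -/
structure IsTree (step : PorosityNode f → ℕ → Set (PorosityNode f)) : Prop where
  anti : ∀ c, Antitone (step c)
  layer : ∀ c i, IsLayer c i (step c i)
  shrink_mem : ∀ c i, c.shrink ∈ step c i
  approximates : ∀ c, ∀ i ≤ c.n, Approximates c i (step c (i + 1)) (step c i)

/-- `d` is reached from `c` by finitely many steps of level at least `i`. -/
def Desc (step : PorosityNode f → ℕ → Set (PorosityNode f)) (i : ℕ) :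
    PorosityNode f → PorosityNode f → Prop :=
  Relation.ReflTransGen fun c d => d ∈ step c i

/-- The points represented by the descendants of `c` of level at least `i`. -/
def offspring (step : PorosityNode f → ℕ → Set (PorosityNode f)) (i : ℕ)
    (c : PorosityNode f) : Set X :=
  pt '' {d | Desc step i c d}

variable {step : PorosityNode f → ℕ → Set (PorosityNode f)} {i j : ℕ} {c d : PorosityNode f}

theorem Desc.mono (hT : IsTree step) (hij : i ≤ j) (h : Desc step j c d) : Desc step i c d :=
  Relation.ReflTransGen.mono (fun c _ hd => hT.anti c hij hd) _ _ h

theorem Desc.n_le (hT : IsTree step) (h : Desc step i c d) (hi : i ≤ c.n) : i ≤ d.n := by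
  induction h with
  | refl => exact hi
  | tail _ hd ih => exact ((hT.layer _ _).succ _ hd).n_le ih

theorem Desc.A_subset (hT : IsTree step) (h : Desc step i c d) : d.A i ⊆ c.A i := by
  induction h with
  | refl => exact subset_rfl
  | tail _ hd ih => exact ((hT.layer _ _).succ _ hd).A_subset.trans ih

theorem Desc.dist_add_le (hT : IsTree step) (h : Desc step i c d) :
    dist d.pt c.pt + 2 * d.rad i ≤ 2 * c.rad i := by
  induction h with
  | refl => simp
  | @tail b d _ hd ih =>
    linarith [((hT.layer _ _).succ _ hd).dist_add_le, dist_triangle d.pt b.pt c.pt]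

theorem Desc.dist_le (hT : IsTree step) (h : Desc step i c d) :
    dist d.pt c.pt ≤ 2 * c.rad i := by
  linarith [h.dist_add_le hT, d.rad_pos i]

theorem offspring_subset (h : Desc step i c d) : offspring step i d ⊆ offspring step i c :=
  image_mono fun _ he => h.trans he

theorem offspring_anti (hT : IsTree step) (hij : i ≤ j) (c : PorosityNode f) :
    offspring step j c ⊆ offspring step i c :=
  image_mono fun _ he => Desc.mono hT hij he

theorem closure_offspring_subset (hT : IsTree step) (c : PorosityNode f) :
    closure (offspring step i c) ⊆ closedBall c.pt (2 * c.rad i) := by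
  refine closure_minimal ?_ isClosed_closedBall
  rintro _ ⟨d, hd, rfl⟩
  exact Desc.dist_le hT hd

theorem exists_desc_deep (hT : IsTree step) (c : PorosityNode f) (m : ℕ) :
    ∃ d : PorosityNode f, (∀ i, Desc step i c d) ∧ d.z = c.z ∧ d.n = c.n ∧ d.A = c.A ∧
      m ≤ d.k := by
  induction m with
  | zero => exact ⟨c, fun _ => Relation.ReflTransGen.refl, rfl, rfl, rfl, Nat.zero_le _⟩
  | succ m ih =>
    obtain ⟨d, h, h1, h2, h3, h4⟩ := ih
    exact ⟨d.shrink, fun i => (h i).tail (hT.shrink_mem d i), h1, h2, h3, Nat.succ_le_succ h4⟩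

/-- Points of level `i` near `c` are well approximated by descendants of level `i`, relative to
the distance to a descendant of level `i + 1`. -/
theorem exists_mem_offspring_dist_le (hT : IsTree step) {e : PorosityNode f}
    (h : Desc step (i + 1) c e) (hi : i ≤ c.n) {x : X} (hx : x ∈ f '' c.A i)
    (hxc : dist x c.pt < c.rad i) (hxe : e.rad i ≤ dist x e.pt) :
    ∃ y ∈ offspring step i c, dist x y ≤ 1 / (8 * (i + 1)) * dist x e.pt := by
  induction h using Relation.ReflTransGen.head_induction_on with
  | refl => exact absurd hxc hxe.not_gt
  | @head c d hd hde ih =>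
    have hsucc := (hT.layer c (i + 1)).succ d hd
    have hA : d.A i = c.A i := hsucc.A_eq (Nat.lt_succ_self i)
    rcases lt_or_ge (dist x d.pt) (d.rad i) with hlt | hge
    · obtain ⟨y, hy, hxy⟩ := ih ((hsucc.mono i.le_succ).n_le hi) (hA ▸ hx) hlt
      exact ⟨y, offspring_subset (Relation.ReflTransGen.single (hT.anti c i.le_succ hd)) hy, hxy⟩
    · obtain ⟨d', hd', hxd'⟩ := hT.approximates c i hi x hx hxc d hd hge
      refine ⟨d'.pt, ⟨d', Relation.ReflTransGen.single hd', rfl⟩, hxd'.trans ?_⟩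
      have h1 : dist e.pt d.pt ≤ 2 * d.rad (i + 1) := Desc.dist_le hT hde
      rw [rad_succ] at h1
      have h2 : dist x d.pt ≤ 2 * dist x e.pt := by
        linarith [dist_triangle x e.pt d.pt, dist_nonneg (x := x) (y := e.pt)]
      have h3 : (1 : ℝ) / (16 * (c.n + 1)) ≤ 1 / (16 * (i + 1)) := by
        have : (i : ℝ) ≤ c.n := by exact_mod_cast hi
        gcongr
      calc 1 / (16 * ((c.n : ℝ) + 1)) * dist x d.pt
          ≤ 1 / (16 * (i + 1)) * (2 * dist x e.pt) := by gcongr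
        _ = 1 / (8 * (i + 1)) * dist x e.pt := by field_simp; ring

/-- The descendants of level `i` have small porosity at limits of descendants of
level `i + 1`. -/
theorem exists_meetsBalls_offspring (hT : IsTree step) (hi : i + 1 ≤ c.n) {q : X}
    (hq : q ∈ closure (offspring step (i + 1) c)) :
    ∃ ρ > 0, MeetsBalls (offspring step i c) q (1 / (i + 1)) ρ := by
  obtain ⟨ρ, hρ, hmeets⟩ := c.meets i hi
  have hc := c.rad_pos i
  have hqc : dist q c.pt ≤ c.rad i / 4 := by
    have := closure_offspring_subset hT c hq
    rw [mem_closedBall, rad_succ] at this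
    linarith
  refine ⟨min (ρ / 2) (c.rad i / 4), by positivity, fun R hR hRρ z hz => ?_⟩
  have hRρ1 := hRρ.trans_le (min_le_left _ _)
  have hRρ2 := hRρ.trans_le (min_le_right _ _)
  have hη0 : (0 : ℝ) < 1 / (i + 1) := by positivity
  have hη1 : (1 : ℝ) / (i + 1) ≤ 1 := by
    rw [div_le_one (by positivity)]
    linarith [(Nat.cast_nonneg i : (0 : ℝ) ≤ i)]
  have hη2 : (1 : ℝ) / (4 * (i + 1)) * (2 * R) = 1 / (i + 1) * R / 2 := by field_simp; ring
  have hη3 : (1 : ℝ) / (8 * (i + 1)) = 1 / (i + 1) / 8 := by field_simp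
  set η : ℝ := 1 / (i + 1) with hη
  have hηR : 0 < η * R := by positivity
  have hηR' : η * R ≤ R := by nlinarith
  obtain ⟨_, ⟨e, he, rfl⟩, hqe⟩ := Metric.mem_closure_iff.1 hq (η * R / 4) (by positivity)
  have heA : e.z ∈ c.A (i + 1) :=
    Desc.A_subset hT he (e.mem_A (Desc.n_le hT he hi))
  obtain ⟨x, hxz, hx⟩ := hmeets e.z heA (2 * R) (by positivity) (by linarith) z (by
    rw [hη2]
    intro w hw
    have h1 := hz (ball_subset_ball (by linarith) hw)
    rw [mem_ball] at h1 ⊢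
    have : dist q (f e.z) < η * R / 4 := hqe
    linarith [dist_triangle w q (f e.z)])
  rw [hη2] at hxz
  have hxq : dist x q < R := hz (ball_subset_ball (by linarith) hxz)
  rw [mem_ball] at hxz
  by_cases hxe : x = e.pt
  · refine ⟨x, mem_ball.2 (by linarith), ?_⟩
    rw [hxe]
    exact offspring_anti hT i.le_succ c ⟨e, he, rfl⟩
  · have hpos : 0 < dist x e.pt := dist_pos.2 hxe
    obtain ⟨m, hm⟩ := exists_pow_lt_of_lt_one hpos (one_half_lt_one (α := ℝ))
    obtain ⟨e', he', hz', -, -, hk⟩ := exists_desc_deep hT e m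
    have hpt : e'.pt = e.pt := by rw [pt, pt, hz']
    obtain ⟨y, hy, hxy⟩ := exists_mem_offspring_dist_le hT (he.trans (he' _)) (by omega) hx
      (by linarith [dist_triangle x q c.pt])
      (by
        rw [hpt]
        refine ((e'.rad_le i).trans ?_).trans hm.le
        exact pow_le_pow_of_le_one (by norm_num) (by norm_num) hk)
    refine ⟨y, ?_, hy⟩
    rw [hpt, hη3] at hxy
    have h1 : dist x e.pt ≤ 2 * R := by linarith [dist_triangle x q e.pt]
    have h2 : η / 8 * dist x e.pt ≤ η / 8 * (2 * R) := by gcongr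
    rw [mem_ball]
    linarith [dist_triangle_left y z x]

theorem Desc.pt_eq_or_lt_n (hT : IsTree step) (h : Desc step i c d) :
    d.pt = c.pt ∨ i + 1 ≤ d.n := by
  induction h with
  | refl => exact Or.inl rfl
  | tail _ hd ih =>
    rcases (hT.layer _ _).succ _ hd with h | ⟨l, hl, h⟩
    · rwa [pt, h.z, h.n]
    · exact Or.inr (by rw [h.n]; omega)

theorem exists_desc_lt_n (hf : Continuous f) (hsing : ∀ z, SigmaUpperPorous {f z})
    (hT : IsTree step) (hi : i ≤ c.n) : ∃ d, Desc step i c d ∧ i + 1 ≤ d.n := by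
  have hcV : c.z ∈ f ⁻¹' ball c.pt (c.rad i) := mem_ball_self (c.rad_pos i)
  have hthick := c.thick i hi _ (isOpen_ball.preimage hf) ⟨c.z, hcV, c.mem_A hi⟩
  obtain ⟨x, ⟨a, ⟨hac, haA⟩, rfl⟩, hne⟩ := not_subset.1 fun h =>
    hthick (SigmaUpperPorous.mono h (hsing c.z))
  have hpos : 0 < dist (f a) c.pt := dist_pos.2 hne
  obtain ⟨m, hm⟩ := exists_pow_lt_of_lt_one hpos (one_half_lt_one (α := ℝ))
  obtain ⟨e, he, hz, -, -, hk⟩ := exists_desc_deep hT c m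
  have hpt : e.pt = c.pt := by rw [pt, pt, hz]
  obtain ⟨_, ⟨d, hd, rfl⟩, hxd⟩ := exists_mem_offspring_dist_le hT (he (i + 1)) hi
    (mem_image_of_mem f haA) hac (by
      rw [hpt]
      exact ((e.rad_le i).trans
        (pow_le_pow_of_le_one (by norm_num) (by norm_num) hk)).trans hm.le)
  refine ⟨d, hd, (Desc.pt_eq_or_lt_n hT hd).resolve_left fun hdc => ?_⟩
  rw [hpt, hdc] at hxd
  have h1 : (1 : ℝ) / (8 * (i + 1)) < 1 := by
    rw [div_lt_one (by positivity)]
    linarith [(Nat.cast_nonneg i : (0 : ℝ) ≤ i)]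
  nlinarith

/-- There are small descendants with long chains. -/
theorem exists_desc_small (hf : Continuous f) (hsing : ∀ z, SigmaUpperPorous {f z})
    (hT : IsTree step) (hi : i ≤ c.n) {ε : ℝ} (hε : 0 < ε) :
    ∃ d, Desc step i c d ∧ i + 1 ≤ d.n ∧ closure (offspring step i d) ⊆ ball c.pt ε := by
  obtain ⟨m, hm⟩ := exists_pow_lt_of_lt_one (half_pos hε) (one_half_lt_one (α := ℝ))
  obtain ⟨e, he, hz, hn, -, hk⟩ := exists_desc_deep hT c m
  have hpt : e.pt = c.pt := by rw [pt, pt, hz]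
  obtain ⟨d, hd, hdn⟩ := exists_desc_lt_n hf hsing hT (hn.symm ▸ hi : i ≤ e.n)
  refine ⟨d, (he i).trans hd, hdn, (closure_mono (offspring_subset hd)).trans
    ((closure_offspring_subset hT e).trans ?_)⟩
  rw [hpt]
  refine closedBall_subset_ball ?_
  have h1 : ((1 : ℝ) / 2) ^ e.k ≤ (1 / 2) ^ m :=
    pow_le_pow_of_le_one (by norm_num) (by norm_num) hk
  linarith [e.rad_le i]

theorem exists_step_of_mem_closure (hT : IsTree step) {x : X}
    (hx : x ∈ closure (offspring step 0 c)) :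
    ∃ d ∈ step c 0, x ∈ closure (offspring step 0 d) := by
  obtain ⟨u, hu, hfin⟩ := (hT.layer c 0).locallyFinite x
  have hsub : ball x u ∩ offspring step 0 c ⊆
      ⋃ d ∈ {d ∈ step c 0 | (closedBall d.pt (2 * d.δ) ∩ ball x u).Nonempty},
        offspring step 0 d := by
    rintro y ⟨hyu, e, he, rfl⟩
    have : ∃ d ∈ step c 0, e.pt ∈ offspring step 0 d := by
      rcases Relation.ReflTransGen.cases_head he with rfl | ⟨d, hd, hde⟩
      · exact ⟨c.shrink, hT.shrink_mem c 0, c.shrink, Relation.ReflTransGen.refl, rfl⟩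
      · exact ⟨d, hd, e, hde, rfl⟩
    obtain ⟨d, hd, hed⟩ := this
    refine mem_biUnion ⟨hd, e.pt, ?_, hyu⟩ hed
    rw [← rad_zero]
    exact closure_offspring_subset hT d (subset_closure hed)
  have hx' := closure_mono hsub (isOpen_ball.inter_closure ⟨mem_ball_self hu, hx⟩)
  rw [hfin.closure_biUnion] at hx'
  obtain ⟨d, hd, hxd⟩ := mem_iUnion₂.1 hx'
  exact ⟨d, hd.1, hxd⟩

theorem le_k_of_succ {b : ℕ → PorosityNode f} (hb : ∀ n, Succ 0 (b n) (b (n + 1))) (n : ℕ) :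
    n ≤ (b n).k := by
  induction n with
  | zero => exact Nat.zero_le _
  | succ n ih => rw [(hb n).k_eq]; omega

theorem cauchySeq_of_succ {b : ℕ → PorosityNode f} (hb : ∀ n, Succ 0 (b n) (b (n + 1))) :
    CauchySeq fun n => (b n).z := by
  classical
  refine Metric.cauchySeq_iff'.2 fun ε hε => ?_
  obtain ⟨m, hm⟩ := exists_pow_lt_of_lt_one hε (one_half_lt_one (α := ℝ))
  by_cases hmove : ∃ l K, m ≤ K ∧ IsMove (b K) (b (K + 1)) l
  · obtain ⟨K, hmK, hK⟩ := Nat.find_spec hmove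
    set l := Nat.find hmove
    have hsucc : ∀ n, K + 1 ≤ n → Succ l (b n) (b (n + 1)) := fun n hn =>
      (hb n).imp id fun ⟨l', _, h⟩ => ⟨l', Nat.find_min' hmove ⟨n, by omega, h⟩, h⟩
    have hdesc : ∀ n, K + 1 ≤ n → l ≤ (b n).n ∧ (b n).A l ⊆ (b (K + 1)).A l := by
      intro n hn
      induction n, hn using Nat.le_induction with
      | base => exact ⟨by rw [hK.n]; omega, subset_rfl⟩
      | succ n hn ih => exact ⟨(hsucc n hn).n_le ih.1, (hsucc n hn).A_subset.trans ih.2⟩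
    have hmem : ∀ n, K + 1 ≤ n → (b n).z ∈ (b (K + 1)).A l := fun n hn =>
      (hdesc n hn).2 ((b n).mem_A (hdesc n hn).1)
    refine ⟨K + 1, fun n hn => (hK.diam _ (hmem n hn) _ (hmem _ le_rfl)).trans_lt ?_⟩
    exact (pow_le_pow_of_le_one (by norm_num) (by norm_num)
      (hmK.trans (le_k_of_succ hb K))).trans_lt hm
  · push Not at hmove
    refine ⟨m, fun n hn => ?_⟩
    have hconst : (b n).z = (b m).z := by
      induction n, hn using Nat.le_induction with
      | base => rfl
      | succ n hn ih =>
        rcases hb n with h | ⟨l, -, h⟩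
        · rw [h.z, ih]
        · exact (hmove l n hn h).elim
    rwa [hconst, dist_self]

theorem closure_offspring_subset_range [CompleteSpace Z] (hf : Continuous f) (hT : IsTree step)
    (c : PorosityNode f) : closure (offspring step 0 c) ⊆ range f := by
  intro x hx
  choose next hnext hnext' using fun d : {d : PorosityNode f // x ∈ closure (offspring step 0 d)} =>
    exists_step_of_mem_closure hT d.2
  let b : ℕ → {d : PorosityNode f // x ∈ closure (offspring step 0 d)} := fun n =>
    Nat.rec ⟨c, hx⟩ (fun _ d => ⟨next d, hnext' d⟩) n
  have hb : ∀ n, Succ 0 (b n).1 (b (n + 1)).1 := fun n =>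
    (hT.layer _ _).succ _ (hnext (b n))
  have hk := le_k_of_succ (b := fun n => (b n).1) hb
  obtain ⟨ζ, hζ⟩ := cauchySeq_tendsto_of_complete (cauchySeq_of_succ (b := fun n => (b n).1) hb)
  refine ⟨ζ, tendsto_nhds_unique ((hf.tendsto ζ).comp hζ) ?_⟩
  rw [tendsto_iff_dist_tendsto_zero]
  refine squeeze_zero (g := fun n => 2 * (1 / 2) ^ n) (fun _ => dist_nonneg) (fun n => ?_) ?_
  · have h1 := closure_offspring_subset hT _ (b n).2
    rw [mem_closedBall, dist_comm] at h1
    have h2 : ((1 : ℝ) / 2) ^ (b n).1.k ≤ (1 / 2) ^ n :=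
      pow_le_pow_of_le_one (by norm_num) (by norm_num) (hk n)
    exact h1.trans (by linarith [(b n).1.rad_le 0])
  · simpa using (tendsto_pow_atTop_nhds_zero_of_lt_one (r := (1 / 2 : ℝ)) (by norm_num)
      (by norm_num)).const_mul 2

/-- A single porosity-bounded piece is avoided by the limits of the descendants of a suitable
descendant. -/
theorem exists_desc_disjoint (hf : Continuous f) (hsing : ∀ z, SigmaUpperPorous {f z})
    (hT : IsTree step) (hi : i ≤ c.n) (B : Set X) :
    ∃ d, Desc step i c d ∧ i + 1 ≤ d.n ∧ ∀ q ∈ closure (offspring step (i + 1) d), q ∈ B →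
      ¬ ENNReal.ofReal (1 / (i + 1)) <
        limsup (fun R : ℝ => porosityGamma B q R / ENNReal.ofReal R) (𝓝[>] (0 : ℝ)) := by
  set B' : Set X := {q ∈ B | ENNReal.ofReal (1 / (i + 1)) <
    limsup (fun R : ℝ => porosityGamma B q R / ENNReal.ofReal R) (𝓝[>] (0 : ℝ))} with hB'
  by_cases hdense : offspring step i c ⊆ closure B'
  · obtain ⟨d, hd, hdn⟩ := exists_desc_lt_n hf hsing hT hi
    refine ⟨d, hd, hdn, fun q hq _ hlim => ?_⟩
    obtain ⟨ρ, hρ, hmeets⟩ := exists_meetsBalls_offspring hT hdn hq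
    obtain ⟨R, hR, hRρ, z, hz⟩ := exists_ball_subset_of_lt_limsup (by positivity) hlim hρ
    obtain ⟨y, hyz, hy⟩ := hmeets R hR hRρ z (hz.trans sdiff_subset)
    obtain ⟨w, hwz, hw⟩ := mem_closure_iff.1 (hdense (offspring_subset hd hy)) _ isOpen_ball hyz
    exact (hz hwz).2 hw.1
  · obtain ⟨_, ⟨e, he, rfl⟩, hne⟩ := not_subset.1 hdense
    obtain ⟨ε, hε, hball⟩ := Metric.isOpen_iff.1 isClosed_closure.isOpen_compl _ hne
    obtain ⟨d, hd, hdn, hsub⟩ := exists_desc_small hf hsing hT (Desc.n_le hT he hi) hε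
    refine ⟨d, he.trans hd, hdn, fun q hq hqB hlim => ?_⟩
    exact hball (hsub (closure_mono (offspring_anti hT i.le_succ d) hq))
      (subset_closure ⟨hqB, hlim⟩)

theorem not_sigmaUpperPorous_closure_offspring [CompleteSpace Z] (hf : Continuous f)
    (hsing : ∀ z, SigmaUpperPorous {f z}) (hT : IsTree step) (c : PorosityNode f) :
    ¬ SigmaUpperPorous (closure (offspring step 0 c)) := by
  rintro ⟨B, hB, hBc⟩
  choose next hdesc hn hdisj using fun (i : ℕ) (d : {d : PorosityNode f // i ≤ d.n}) =>
    exists_desc_disjoint hf hsing hT d.2 (B i.unpair.1)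
  let b : ∀ i, {d : PorosityNode f // i ≤ d.n} := fun i =>
    Nat.rec ⟨c, Nat.zero_le _⟩ (fun i d => ⟨next i d, hn i d⟩) i
  have hb : ∀ i j, i ≤ j → Desc step i (b i).1 (b j).1 := by
    intro i j hij
    induction j, hij using Nat.le_induction with
    | base => exact Relation.ReflTransGen.refl
    | succ j hij ih => exact ih.trans (Desc.mono hT hij (hdesc j (b j)))
  have hmem : ∀ i j, i ≤ j → (b j).1.z ∈ (b i).1.A i := fun i j hij =>
    Desc.A_subset hT (hb i j hij) ((b j).1.mem_A (hij.trans (b j).2))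
  have hcauchy : CauchySeq fun i => (b i).1.z := by
    refine Metric.cauchySeq_iff'.2 fun ε hε => ?_
    obtain ⟨m, hm⟩ := exists_pow_lt_of_lt_one hε (one_half_lt_one (α := ℝ))
    exact ⟨m, fun n hn => ((b m).1.diam m (b m).2 _ (hmem m n hn) _ (hmem m m le_rfl)).trans_lt hm⟩
  obtain ⟨ζ, hζ⟩ := cauchySeq_tendsto_of_complete hcauchy
  have hq : ∀ i, f ζ ∈ closure (offspring step i (b i).1) := fun i =>
    mem_closure_of_tendsto ((hf.tendsto ζ).comp hζ)
      ((eventually_ge_atTop i).mono fun j hij => ⟨(b j).1, hb i j hij, rfl⟩)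
  have hq0 : f ζ ∈ ⋃ n, B n := hBc ▸ hq 0
  obtain ⟨j, hj⟩ := mem_iUnion.1 hq0
  have hpor : 0 < limsup (fun R : ℝ => porosityGamma (B j) (f ζ) R / ENNReal.ofReal R)
    (𝓝[>] (0 : ℝ)) := hB j _ hj
  obtain ⟨M, hM⟩ := ENNReal.exists_inv_nat_lt hpor.ne'
  have hdisj' := hdisj (Nat.pair j M) (b (Nat.pair j M)) (f ζ) (hq (Nat.pair j M + 1))
  rw [Nat.unpair_pair] at hdisj'
  refine hdisj' hj (lt_of_le_of_lt ?_ hM)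
  rcases M.eq_zero_or_pos with rfl | hM0
  · simp
  rw [← ENNReal.ofReal_natCast, ← ENNReal.ofReal_inv_of_pos (by exact_mod_cast hM0), ← one_div]
  refine ENNReal.ofReal_le_ofReal ?_
  have : (M : ℝ) ≤ Nat.pair j M := by exact_mod_cast Nat.right_le_pair j M
  have hM0' : (0 : ℝ) < M := by exact_mod_cast hM0
  exact one_div_le_one_div_of_le hM0' (by linarith)

end PorosityNode

theorem exists_porosityNode [SecondCountableTopology Z] (h : ¬ SigmaUpperPorous (range f)) :
    Nonempty (PorosityNode f) := by
  rw [← image_univ] at h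
  obtain ⟨B, -, ⟨z, hz⟩, hB⟩ := exists_thick_subset h
  exact ⟨{
    z := z
    n := 0
    k := 0
    A := fun _ => ball z (1 / 2) ∩ B
    δ := 1
    mem := ⟨mem_ball_self (by norm_num), hz⟩
    anti := fun _ h => (Nat.not_lt_zero _ h).elim
    thick := fun _ _ => hB.inter_open isOpen_ball
    meets := fun _ h => (Nat.not_lt_zero _ h).elim
    diam := by
      intro i hi a ha b hb
      rw [Nat.le_zero.1 hi, pow_zero]
      linarith [dist_triangle_right a b z, mem_ball.1 ha.1, mem_ball.1 hb.1]
    pos := one_pos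
    le := by simp }⟩

theorem exists_closed_subset_range_not_sigmaUpperPorous [CompleteSpace Z]
    [SecondCountableTopology Z] (hf : Continuous f) (h : ¬ SigmaUpperPorous (range f)) :
    ∃ F ⊆ range f, IsClosed F ∧ ¬ SigmaUpperPorous F := by
  by_cases hsing : ∀ z, SigmaUpperPorous {f z}
  · obtain ⟨c⟩ := exists_porosityNode h
    choose step h1 h2 h3 h4 using PorosityNode.exists_layers hf
    have hT : PorosityNode.IsTree step := ⟨h1, h2, h3, h4⟩
    exact ⟨_, PorosityNode.closure_offspring_subset_range hf hT c, isClosed_closure,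
      PorosityNode.not_sigmaUpperPorous_closure_offspring hf hsing hT c⟩
  · push Not at hsing
    obtain ⟨z, hz⟩ := hsing
    exact ⟨{f z}, singleton_subset_iff.2 (mem_range_self z), isClosed_singleton, hz⟩

end Nodes

/-- Pelant–Zelený inscribing theorem: every non-σ-upper-porous Suslin subset of a topologically
complete metric space contains a closed non-σ-upper-porous subset. -/
theorem exists_closed_not_sigmaUpperPorous_subset {X : Type*} [MetricSpace X]
    (hX : TopComplete X) (S : Set X) (hS : MeasureTheory.AnalyticSet S)
    (hpor : ¬ SigmaUpperPorous S) :
    ∃ F : Set X, F ⊆ S ∧ IsClosed F ∧ ¬ SigmaUpperPorous F := by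
  rw [MeasureTheory.AnalyticSet] at hS
  rcases hS with rfl | ⟨f, hf, rfl⟩
  · exact (hpor sigmaUpperPorous_empty).elim
  · let _ := upgradeIsCompletelyMetrizable (ℕ → ℕ)
    exact exists_closed_subset_range_not_sigmaUpperPorous hf hpor
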